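/- The images in A of the monomials Fⁿ (n ≥ 0), H·Fᵐ (m ≥ 0), and Kᵏ (k ≥ 1) form a basis of A as an R-module if and only if the coefficients satisfy the five relations s = e² − b·(π + b²), d = a·e, p = 0, q = a·b, and u = a·(π + b²). -/

import Mathlib

open MvPolynomial

/-- The defining relations of the algebra `A`, for elements `F`, `H`, `K` of an `R`-algebra. -/
structure CurveRelations {R A : Type*} [CommRing R] [CommRing A] [Algebra R A]
    (π s a b d e p q u : R) (F H K : A) : Prop where
  sq : H ^ 2 = F ^ 3 + algebraMap R A π * F + algebraMap R A s
  mul_left : F * K = algebraMap R A a * H + algebraMap R A b * K + algebraMap R A d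
  mul_right : H * K = algebraMap R A a * F ^ 2 + algebraMap R A e * K + algebraMap R A p * H +
    algebraMap R A q * F + algebraMap R A u

/-- The monomials `Fⁿ`, `H * Fᵐ` and `Kᵏ⁺¹`. -/
def normalMonomial {A : Type*} [CommRing A] (F H K : A) : ℕ ⊕ ℕ ⊕ ℕ → A :=
  Sum.elim (fun n => F ^ n) (Sum.elim (fun m => H * F ^ m) fun k => K ^ (k + 1))

@[simp]
theorem normalMonomial_inl {A : Type*} [CommRing A] (F H K : A) (n : ℕ) :
    normalMonomial F H K (Sum.inl n) = F ^ n := rfl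

@[simp]
theorem normalMonomial_inr_inl {A : Type*} [CommRing A] (F H K : A) (m : ℕ) :
    normalMonomial F H K (Sum.inr (Sum.inl m)) = H * F ^ m := rfl

@[simp]
theorem normalMonomial_inr_inr {A : Type*} [CommRing A] (F H K : A) (k : ℕ) :
    normalMonomial F H K (Sum.inr (Sum.inr k)) = K ^ (k + 1) := rfl

theorem map_normalMonomial {A B : Type*} [CommRing A] [CommRing B] (f : A →+* B) (F H K : A)
    (i : ℕ ⊕ ℕ ⊕ ℕ) :
    f (normalMonomial F H K i) = normalMonomial (f F) (f H) (f K) i := by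
  rcases i with n | m | k <;> simp

namespace CurveRelations

variable {R A : Type*} [CommRing R] [CommRing A] [Algebra R A]
  {π s a b d e p q u : R} {F H K : A}

theorem pow_mul_mem_span (h : CurveRelations π s a b d e p q u F H K) (k : ℕ) :
    ∀ n : ℕ, F ^ n * K ^ k ∈ Submodule.span R (Set.range (normalMonomial F H K)) ∧
      H * F ^ n * K ^ k ∈ Submodule.span R (Set.range (normalMonomial F H K)) := by
  set S := Submodule.span R (Set.range (normalMonomial F H K)) with hS
  have hv (i) : normalMonomial F H K i ∈ S := Submodule.subset_span ⟨i, rfl⟩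
  induction k with
  | zero =>
    intro n
    simpa using ⟨hv (Sum.inl n), hv (Sum.inr (Sum.inl n))⟩
  | succ k ih =>
    have step (n : ℕ) (hn : F ^ n * K ^ (k + 1) ∈ S) : H * F ^ n * K ^ (k + 1) ∈ S := by
      have key : H * F ^ n * K ^ (k + 1) = a • (F ^ (n + 2) * K ^ k) + e • (F ^ n * K ^ (k + 1)) +
          p • (H * F ^ n * K ^ k) + q • (F ^ (n + 1) * K ^ k) + u • (F ^ n * K ^ k) := by
        simp only [Algebra.smul_def]
        linear_combination F ^ n * K ^ k * h.mul_right
      rw [key]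
      exact S.add_mem (S.add_mem (S.add_mem (S.add_mem (S.smul_mem _ (ih _).1) (S.smul_mem _ hn))
        (S.smul_mem _ (ih _).2)) (S.smul_mem _ (ih _).1)) (S.smul_mem _ (ih _).1)
    suffices hF : ∀ n, F ^ n * K ^ (k + 1) ∈ S from fun n => ⟨hF n, step n (hF n)⟩
    intro n
    induction n with
    | zero => simpa using hv (Sum.inr (Sum.inr k))
    | succ n ihn =>
      have key : F ^ (n + 1) * K ^ (k + 1) = a • (H * F ^ n * K ^ k) + b • (F ^ n * K ^ (k + 1)) +
          d • (F ^ n * K ^ k) := by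
        simp only [Algebra.smul_def]
        linear_combination F ^ n * K ^ k * h.mul_left
      rw [key]
      exact S.add_mem (S.add_mem (S.smul_mem _ (ih _).2) (S.smul_mem _ ihn))
        (S.smul_mem _ (ih _).1)

theorem aeval_mem_span (h : CurveRelations π s a b d e p q u F H K)
    (P : MvPolynomial (Fin 3) R) :
    aeval ![F, H, K] P ∈ Submodule.span R (Set.range (normalMonomial F H K)) := by
  set S := Submodule.span R (Set.range (normalMonomial F H K)) with hS
  have hFK (n k : ℕ) : F ^ n * K ^ k ∈ S := (h.pow_mul_mem_span k n).1
  have hHFK (n k : ℕ) : H * F ^ n * K ^ k ∈ S := (h.pow_mul_mem_span k n).2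
  have mul_mem (j : Fin 3) (x : A) (hx : x ∈ S) : x * ![F, H, K] j ∈ S := by
    have hle : S ≤ S.comap (LinearMap.mulRight R (![F, H, K] j)) := by
      rw [hS, Submodule.span_le]
      rintro _ ⟨i, rfl⟩
      change normalMonomial F H K i * ![F, H, K] j ∈ S
      rcases i with n | m | k <;> fin_cases j <;> simp only [normalMonomial_inl,
        normalMonomial_inr_inl, normalMonomial_inr_inr, Fin.reduceFinMk,
        Matrix.cons_val, Fin.zero_eta, Fin.mk_one, Matrix.cons_val_zero, Matrix.cons_val_one]
      · simpa [pow_succ] using hFK (n + 1) 0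
      · simpa [mul_comm] using hHFK n 0
      · simpa using hFK n 1
      · simpa [pow_succ, mul_assoc] using hHFK (m + 1) 0
      · have key : H * F ^ m * H = F ^ (m + 3) * K ^ 0 + π • (F ^ (m + 1) * K ^ 0) +
            s • (F ^ m * K ^ 0) := by
          simp only [Algebra.smul_def]
          linear_combination F ^ m * h.sq
        rw [key]
        exact S.add_mem (S.add_mem (hFK _ _) (S.smul_mem _ (hFK _ _))) (S.smul_mem _ (hFK _ _))
      · simpa using hHFK m 1
      · simpa [mul_comm] using hFK 1 (k + 1)
      · simpa [mul_comm] using hHFK 0 (k + 1)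
      · simpa [pow_succ] using hFK 0 (k + 2)
    exact hle hx
  induction P using MvPolynomial.induction_on with
  | C r => simpa [Algebra.smul_def] using S.smul_mem r (hFK 0 0)
  | add P Q hP hQ => simpa using S.add_mem hP hQ
  | mul_X P j hP => simpa using mul_mem j _ hP

theorem coefficients_of_linearIndependent (h : CurveRelations π s a b d e p q u F H K)
    (hli : LinearIndependent R (normalMonomial F H K)) :
    s = e ^ 2 - b * (π + b ^ 2) ∧ d = a * e ∧ p = 0 ∧ q = a * b ∧ u = a * (π + b ^ 2) := by
  have key := linearIndependent_iff.1 hli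
    (Finsupp.single (Sum.inl 2) (a * b - q) + Finsupp.single (Sum.inr (Sum.inl 1)) (-p) +
      Finsupp.single (Sum.inl 1) (a * π + b * q - u) +
      Finsupp.single (Sum.inr (Sum.inl 0)) (b * p + d - e * a) +
      Finsupp.single (Sum.inl 0) (a * s + b * u - e * d)) (by
    simp only [map_add, Finsupp.linearCombination_single, normalMonomial_inl,
      normalMonomial_inr_inl, Algebra.smul_def,
      map_sub, map_mul, map_neg]
    linear_combination (algebraMap R A e - H) * h.mul_left +
      (F - algebraMap R A b) * h.mul_right - algebraMap R A a * h.sq)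
  have h1 := DFunLike.congr_fun key (Sum.inl 2)
  have h2 := DFunLike.congr_fun key (Sum.inr (Sum.inl 1))
  have h3 := DFunLike.congr_fun key (Sum.inl 1)
  have h4 := DFunLike.congr_fun key (Sum.inr (Sum.inl 0))
  simp at h1 h2 h3 h4
  obtain rfl : q = a * b := by linear_combination -h1
  subst h2
  obtain rfl : u = a * (π + b ^ 2) := by linear_combination -h3
  obtain rfl : d = a * e := by linear_combination h4
  have key' := linearIndependent_iff.1 hli
    (Finsupp.single (Sum.inr (Sum.inr 0)) (s + b * (π + b ^ 2) - e ^ 2)) (by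
    have h1 := h.sq
    have h2 := h.mul_left
    have h3 := h.mul_right
    simp only [Finsupp.linearCombination_single, normalMonomial_inr_inr, Algebra.smul_def,
      map_sub, map_add, map_mul, map_pow, map_zero] at h1 h2 h3 ⊢
    linear_combination (-K) * h1 + (H + algebraMap R A e) * h3 -
      (F ^ 2 + algebraMap R A b * F + algebraMap R A b ^ 2 + algebraMap R A π) * h2)
  have h5 := DFunLike.congr_fun key' (Sum.inr (Sum.inr 0))
  simp at h5
  exact ⟨by linear_combination h5, rfl, rfl, rfl, rfl⟩

end CurveRelations

/-- A quadratic equation over `R⟦X⟧` whose reduction modulo `X` is `-x = 0` has a root. -/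
theorem PowerSeries.exists_quadratic_root {R : Type*} [CommRing R] (α β γ : PowerSeries R) :
    ∃ x : PowerSeries R, x = X * (α * x ^ 2 + β * x + γ) := by
  let B : PowerSeries R := X * β - 1
  let D : PowerSeries R := (X * α) * (X * γ)
  let f : Polynomial (PowerSeries R) :=
    Polynomial.X ^ 2 + (Polynomial.C B * Polynomial.X + Polynomial.C D)
  have hf : f.Monic := Polynomial.monic_X_pow_add (by compute_degree!)
  have hX (y : PowerSeries R) : X * y ∈ Ideal.span {(X : PowerSeries R)} :=
    Ideal.mul_mem_right _ _ (Ideal.mem_span_singleton_self _)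
  obtain ⟨z, hz, hz0⟩ := HenselianRing.is_henselian (I := Ideal.span {(X : PowerSeries R)}) f hf 0
    (by simpa [f, D, mul_assoc] using hX _)
    (by
      have hB : IsUnit B := by
        rw [PowerSeries.isUnit_iff_constantCoeff]
        simp [B]
      simpa [f] using hB.map (Ideal.Quotient.mk (Ideal.span {(X : PowerSeries R)})))
  rw [sub_zero, Ideal.mem_span_singleton] at hz0
  have hu : IsUnit (z + B) := by
    obtain ⟨y, rfl⟩ := hz0
    rw [PowerSeries.isUnit_iff_constantCoeff]
    simp [B]
  obtain ⟨w, hw⟩ := hu.exists_right_inv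
  have hz' : z ^ 2 + (B * z + D) = 0 := by simpa [f, Polynomial.IsRoot] using hz
  have hz'' : X * α * (-(X * γ) * w) = z := by
    linear_combination (-w) * hz' + z * hw
  refine ⟨-(X * γ) * w, ?_⟩
  linear_combination (X * γ * w) * hz'' + (X * γ) * hw

section Models

variable {R : Type*} [CommRing R] (π a b e : R)

/-- Expansions of `F`, `H`, `K` at the pole of `K`, in the local parameter `K⁻¹`. -/
theorem exists_curveRelations_laurentSeries :
    ∃ F H : PowerSeries R, CurveRelations π (e ^ 2 - b * (π + b ^ 2)) a b (a * e) e 0 (a * b)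
      (a * (π + b ^ 2)) (HahnSeries.ofPowerSeries ℤ R F) (HahnSeries.ofPowerSeries ℤ R H)
      (HahnSeries.single (-1 : ℤ) (1 : R)) := by
  let c : R →+* PowerSeries R := PowerSeries.C
  obtain ⟨x, hx⟩ := PowerSeries.exists_quadratic_root (R := R) (c a ^ 2 * .X)
    (3 * c b * c a ^ 2 * .X) (2 * c e * c a + c a ^ 2 * .X * (3 * c b ^ 2 + c π))
  let y : PowerSeries R := .X * (c a * (x ^ 2 + 3 * c b * x + 3 * c b ^ 2 + c π))
  have hy : y = .X * (c a * (x ^ 2 + 3 * c b * x + 3 * c b ^ 2 + c π)) := rfl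
  have hx' : x = .X * (c a * (y + 2 * c e)) := by
    rw [hy]
    linear_combination hx
  have hXK : HahnSeries.ofPowerSeries ℤ R .X * HahnSeries.single (-1 : ℤ) (1 : R) = 1 := by
    simp [HahnSeries.single_mul_single]
  have hc (r : R) : algebraMap R (LaurentSeries R) r = HahnSeries.ofPowerSeries ℤ R (c r) :=
    HahnSeries.algebraMap_apply' ℤ r
  have hxL := congrArg (HahnSeries.ofPowerSeries ℤ R) hx'
  have hyL := congrArg (HahnSeries.ofPowerSeries ℤ R) hy
  have hsq : (c e + y) ^ 2 = (c b + x) ^ 3 + c π * (c b + x) +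
      (c e ^ 2 - c b * (c π + c b ^ 2)) := by
    linear_combination (y + 2 * c e) * hy - (x ^ 2 + 3 * c b * x + 3 * c b ^ 2 + c π) * hx'
  have hsqL := congrArg (HahnSeries.ofPowerSeries ℤ R) hsq
  refine ⟨c b + x, c e + y, ?_, ?_, ?_⟩
  · simp only [map_add, map_mul, map_sub, map_pow, hc] at hsqL ⊢
    exact hsqL
  · simp only [map_add, map_mul, map_ofNat, hc] at hxL ⊢
    linear_combination HahnSeries.single (-1 : ℤ) (1 : R) * hxL +
      HahnSeries.ofPowerSeries ℤ R (c a) * (HahnSeries.ofPowerSeries ℤ R y +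
        2 * HahnSeries.ofPowerSeries ℤ R (c e)) * hXK
  · simp only [map_add, map_mul, map_pow, map_ofNat, map_zero, hc] at hyL ⊢
    linear_combination HahnSeries.single (-1 : ℤ) (1 : R) * hyL +
      HahnSeries.ofPowerSeries ℤ R (c a) * (HahnSeries.ofPowerSeries ℤ R x ^ 2 +
        3 * HahnSeries.ofPowerSeries ℤ R (c b) * HahnSeries.ofPowerSeries ℤ R x +
        3 * HahnSeries.ofPowerSeries ℤ R (c b) ^ 2 + HahnSeries.ofPowerSeries ℤ R (c π)) * hXK

/-- On the affine cubic `H ^ 2 = g(F)`, with Laurent series in `F⁻¹` as coefficients,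
`K` is the function `a * (H + e) / (F - b)`. -/
theorem exists_curveRelations_quadraticAlgebra :
    ∃ (g : LaurentSeries R) (K : QuadraticAlgebra (LaurentSeries R) g 0),
      CurveRelations π (e ^ 2 - b * (π + b ^ 2)) a b (a * e) e 0 (a * b) (a * (π + b ^ 2))
        (algebraMap _ _ (HahnSeries.single (-1 : ℤ) (1 : R))) ⟨0, 1⟩ K := by
  let F : LaurentSeries R := HahnSeries.single (-1 : ℤ) (1 : R)
  let g : LaurentSeries R := F ^ 3 + algebraMap R _ π * F +
    algebraMap R _ (e ^ 2 - b * (π + b ^ 2))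
  let ω : QuadraticAlgebra (LaurentSeries R) g 0 := ⟨0, 1⟩
  have hunit : IsUnit (F - algebraMap R _ b) := by
    have h1 : IsUnit (1 - .X * PowerSeries.C b : PowerSeries R) := by
      rw [PowerSeries.isUnit_iff_constantCoeff]
      simp
    have hXF : HahnSeries.ofPowerSeries ℤ R .X * F = 1 := by
      simp [F, HahnSeries.single_mul_single]
    have hF : IsUnit F := .of_mul_eq_one_right _ hXF
    have hc : algebraMap R (LaurentSeries R) b =
        HahnSeries.ofPowerSeries ℤ R (PowerSeries.C b) :=
      HahnSeries.algebraMap_apply' ℤ b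
    convert hF.mul (h1.map (HahnSeries.ofPowerSeries ℤ R)) using 1
    simp only [map_sub, map_mul, map_one, hc]
    linear_combination HahnSeries.ofPowerSeries ℤ R (PowerSeries.C b) * hXF
  obtain ⟨w, hw⟩ := hunit.exists_right_inv
  let ι := algebraMap (LaurentSeries R) (QuadraticAlgebra (LaurentSeries R) g 0)
  have hc (r : R) : algebraMap R (QuadraticAlgebra (LaurentSeries R) g 0) r =
      ι (algebraMap R _ r) := rfl
  have hω : ω ^ 2 = ι g := by
    rw [sq]
    ext <;> simp [ω, ι]
  have hw' : (ι F - ι (algebraMap R _ b)) * ι w = 1 := by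
    simpa using congrArg ι hw
  refine ⟨g, ι w * (ι (algebraMap R _ a) * (ω + ι (algebraMap R _ e))), ?_, ?_, ?_⟩
  · change ω ^ 2 = _
    rw [hω]
    simp only [hc, ← map_add, ← map_mul, ← map_pow, ι, g, F]
  · change ι F * _ = _ * ω + _ + _
    simp only [hc, map_mul]
    linear_combination ι (algebraMap R _ a) * (ω + ι (algebraMap R _ e)) * hw'
  · change ω * _ = _ * ι F ^ 2 + _ + _ * ω + _ * ι F + _
    simp only [g, map_add, map_mul, map_pow, map_sub] at hω
    simp only [hc, map_mul, map_add, map_pow, map_zero]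
    linear_combination ι w * ι (algebraMap R _ a) * hω +
      ι (algebraMap R _ a) * (ι F ^ 2 + ι (algebraMap R _ b) * ι F +
        ι (algebraMap R _ b) ^ 2 + ι (algebraMap R _ π)) * hw'

end Models

theorem coeff_single_neg_one_pow {R : Type*} [CommRing R] (m : ℕ) (n : ℤ) :
    (HahnSeries.single (-1 : ℤ) (1 : R) ^ m).coeff n = if n = -m then 1 else 0 := by
  simp [HahnSeries.single_pow, HahnSeries.coeff_single]

theorem coeff_algebraMap_mul_laurentSeries {R : Type*} [CommRing R] (r : R)
    (z : LaurentSeries R) (n : ℤ) :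
    (algebraMap R (LaurentSeries R) r * z).coeff n = r * z.coeff n := by
  rw [HahnSeries.algebraMap_apply', PowerSeries.algebraMap_apply, Algebra.algebraMap_self_apply,
    HahnSeries.ofPowerSeries_C, HahnSeries.C_mul_eq_smul, HahnSeries.coeff_smul, smul_eq_mul]

theorem coeff_ofPowerSeries_neg {R : Type*} [CommRing R] (f : PowerSeries R) {n : ℤ}
    (hn : n < 0) : (HahnSeries.ofPowerSeries ℤ R f).coeff n = 0 := by
  rw [PowerSeries.coeff_coe, if_pos hn]

/-- The normal monomials are independent as soon as they specialize to the two models. -/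
theorem linearIndependent_normalMonomial {R A : Type*} [CommRing R] [CommRing A] [Algebra R A]
    {F H K : A} {g : LaurentSeries R} {F' H' : PowerSeries R}
    (f₁ : A →ₐ[R] LaurentSeries R) (f₂ : A →ₐ[R] QuadraticAlgebra (LaurentSeries R) g 0)
    (hF₁ : f₁ F = HahnSeries.ofPowerSeries ℤ R F') (hH₁ : f₁ H = HahnSeries.ofPowerSeries ℤ R H')
    (hK₁ : f₁ K = HahnSeries.single (-1 : ℤ) (1 : R))
    (hF₂ : f₂ F = algebraMap _ _ (HahnSeries.single (-1 : ℤ) (1 : R))) (hH₂ : f₂ H = ⟨0, 1⟩) :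
    LinearIndependent R (normalMonomial F H K) := by
  rw [linearIndependent_iff]
  intro c hc
  have hv₁ (i) : f₁ (normalMonomial F H K i) = normalMonomial (f₁ F) (f₁ H) (f₁ K) i :=
    map_normalMonomial f₁.toRingHom F H K i
  have hv₂ (i) : f₂ (normalMonomial F H K i) = normalMonomial (f₂ F) (f₂ H) (f₂ K) i :=
    map_normalMonomial f₂.toRingHom F H K i
  have coeff_eq_zero (φ : A →ₗ[R] R) (i₀ : ℕ ⊕ ℕ ⊕ ℕ)
      (hφ : ∀ i, c i ≠ 0 → φ (normalMonomial F H K i) = if i = i₀ then 1 else 0) : c i₀ = 0 := by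
    have h := congrArg φ hc
    rw [Finsupp.apply_linearCombination, map_zero, Finsupp.linearCombination_apply, Finsupp.sum,
      Finset.sum_congr rfl (g := fun i => if i = i₀ then c i else 0)] at h
    · simpa using h
    · intro i hi
      simp [hφ i (Finsupp.mem_support_iff.1 hi)]
  have hK (k : ℕ) : c (Sum.inr (Sum.inr k)) = 0 := by
    let φ : A →ₗ[R] R :=
      { toFun := fun z => (f₁ z).coeff (-(k + 1 : ℕ))
        map_add' := by simp
        map_smul' := fun r z => by
          rw [Algebra.smul_def, map_mul, f₁.commutes, coeff_algebraMap_mul_laurentSeries]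
          rfl }
    refine coeff_eq_zero φ _ fun i _ => ?_
    change (f₁ (normalMonomial F H K i)).coeff (-(k + 1 : ℕ)) = _
    have hneg : (-(k + 1 : ℕ) : ℤ) < 0 := by lia
    rw [hv₁, hF₁, hH₁, hK₁]
    rcases i with n | m | j
    · simp only [normalMonomial_inl, ← map_pow, coeff_ofPowerSeries_neg _ hneg, reduceCtorEq, if_false]
    · simp only [normalMonomial_inr_inl, ← map_pow, ← map_mul,
        coeff_ofPowerSeries_neg _ hneg, reduceCtorEq, Sum.inr.injEq, if_false]
    · rw [normalMonomial_inr_inr, coeff_single_neg_one_pow]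
      simp [eq_comm]
  have hR (r : R) : algebraMap R (QuadraticAlgebra (LaurentSeries R) g 0) r =
      algebraMap (LaurentSeries R) _ (algebraMap R _ r) := rfl
  have hF (n : ℕ) : c (Sum.inl n) = 0 := by
    let φ : A →ₗ[R] R :=
      { toFun := fun z => (f₂ z).re.coeff (-n)
        map_add' := by simp
        map_smul' := fun r z => by
          rw [Algebra.smul_def, map_mul, f₂.commutes, hR, QuadraticAlgebra.re_mul]
          simp [coeff_algebraMap_mul_laurentSeries] }
    refine coeff_eq_zero φ _ fun i hi => ?_
    change (f₂ (normalMonomial F H K i)).re.coeff (-n) = _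
    rw [hv₂, hF₂, hH₂]
    rcases i with m | m | j
    · rw [normalMonomial_inl, ← map_pow, QuadraticAlgebra.algebraMap_re,
        coeff_single_neg_one_pow]
      simp [eq_comm]
    · simp [← map_pow]
    · exact absurd (hK j) hi
  have hH (n : ℕ) : c (Sum.inr (Sum.inl n)) = 0 := by
    let φ : A →ₗ[R] R :=
      { toFun := fun z => (f₂ z).im.coeff (-n)
        map_add' := by simp
        map_smul' := fun r z => by
          rw [Algebra.smul_def, map_mul, f₂.commutes, hR, QuadraticAlgebra.im_mul]
          simp [coeff_algebraMap_mul_laurentSeries] }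
    refine coeff_eq_zero φ _ fun i hi => ?_
    change (f₂ (normalMonomial F H K i)).im.coeff (-n) = _
    rw [hv₂, hF₂, hH₂]
    rcases i with m | m | j
    · exact absurd (hF m) hi
    · rw [normalMonomial_inr_inl, ← map_pow, QuadraticAlgebra.im_mul,
        QuadraticAlgebra.algebraMap_re, QuadraticAlgebra.algebraMap_im]
      simp only [mul_zero, zero_mul, one_mul, zero_add, add_zero, coeff_single_neg_one_pow]
      simp [eq_comm]
    · exact absurd (hK j) hi
  ext (n | m | k)
  · exact hF n
  · exact hH m
  · exact hK k

/-- Let `R` be a commutative ring in which `6` is invertible, fix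
`π, s, a, b, d, e, p, q, u ∈ R`, and let `A = R[F,H,K]/(H² − (F³ + πF + s),
FK − (aH + bK + d), HK − (aF² + eK + pH + qF + u))`. Then the images in `A` of the
monomials `Fⁿ` (`n ≥ 0`), `H·Fᵐ` (`m ≥ 0`) and `Kᵏ` (`k ≥ 1`) form a basis of `A` as
an `R`-module if and only if `s = e² − b(π + b²)`, `d = ae`, `p = 0`, `q = ab` and
`u = a(π + b²)`. -/
theorem normal_monomials_basis_iff (R : Type*) [CommRing R] (h6 : IsUnit (6 : R))
    (π s a b d e p q u : R) :
    letI F : MvPolynomial (Fin 3) R := X 0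
    letI H : MvPolynomial (Fin 3) R := X 1
    letI K : MvPolynomial (Fin 3) R := X 2
    letI I : Ideal (MvPolynomial (Fin 3) R) := Ideal.span
      { H ^ 2 - (F ^ 3 + C π * F + C s),
        F * K - (C a * H + C b * K + C d),
        H * K - (C a * F ^ 2 + C e * K + C p * H + C q * F + C u) }
    letI mk := Ideal.Quotient.mk I
    letI v : ℕ ⊕ ℕ ⊕ ℕ → MvPolynomial (Fin 3) R ⧸ I := fun x =>
      match x with
      | Sum.inl nn => mk (F ^ nn)
      | Sum.inr (Sum.inl m) => mk (H * F ^ m)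
      | Sum.inr (Sum.inr kk) => mk (K ^ (kk + 1))
    (LinearIndependent R v ∧ Submodule.span R (Set.range v) = ⊤) ↔
      (s = e ^ 2 - b * (π + b ^ 2) ∧ d = a * e ∧ p = 0 ∧ q = a * b ∧
        u = a * (π + b ^ 2)) := by
  let F : MvPolynomial (Fin 3) R := X 0
  let H : MvPolynomial (Fin 3) R := X 1
  let K : MvPolynomial (Fin 3) R := X 2
  let I : Ideal (MvPolynomial (Fin 3) R) := Ideal.span
      { H ^ 2 - (F ^ 3 + C π * F + C s),
        F * K - (C a * H + C b * K + C d),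
        H * K - (C a * F ^ 2 + C e * K + C p * H + C q * F + C u) }
  let mk := Ideal.Quotient.mk I
  suffices key : (LinearIndependent R (normalMonomial (mk F) (mk H) (mk K)) ∧
      Submodule.span R (Set.range (normalMonomial (mk F) (mk H) (mk K))) = ⊤) ↔
      (s = e ^ 2 - b * (π + b ^ 2) ∧ d = a * e ∧ p = 0 ∧ q = a * b ∧ u = a * (π + b ^ 2)) by
    have of_eq (v) (hv : v = normalMonomial (mk F) (mk H) (mk K)) :
        (LinearIndependent R v ∧ Submodule.span R (Set.range v) = ⊤) ↔ _ := hv ▸ key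
    refine of_eq _ ?_
    funext i
    rcases i with n | m | k <;> simp [mk, I, F, H, K]
  have hrel : CurveRelations π s a b d e p q u (mk F) (mk H) (mk K) := by
    have hmem (P) (hP : P ∈ ({ H ^ 2 - (F ^ 3 + C π * F + C s),
        F * K - (C a * H + C b * K + C d),
        H * K - (C a * F ^ 2 + C e * K + C p * H + C q * F + C u) } :
          Set (MvPolynomial (Fin 3) R))) : mk P = 0 :=
      Ideal.Quotient.eq_zero_iff_mem.2 (Ideal.subset_span hP)
    have hC (r : R) : algebraMap R (MvPolynomial (Fin 3) R ⧸ I) r = mk (C r) := rfl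
    constructor
    · simpa [hC, sub_eq_zero] using hmem _ (.inl rfl)
    · simpa [hC, sub_eq_zero] using hmem _ (.inr (.inl rfl))
    · simpa [hC, sub_eq_zero] using hmem _ (.inr (.inr rfl))
  have lift {B : Type _} [CommRing B] [Algebra R B] {F' H' K' : B}
      (h : CurveRelations π s a b d e p q u F' H' K') :
      ∃ f : (MvPolynomial (Fin 3) R ⧸ I) →ₐ[R] B,
        f (mk F) = F' ∧ f (mk H) = H' ∧ f (mk K) = K' := by
    have hI : I ≤ RingHom.ker (aeval (R := R) ![F', H', K']) := by
      rw [Ideal.span_le]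
      rintro P (rfl | rfl | rfl)
      · simpa [F, H, K, sub_eq_zero] using h.sq
      · simpa [F, H, K, sub_eq_zero] using h.mul_left
      · simpa [F, H, K, sub_eq_zero] using h.mul_right
    refine ⟨Ideal.Quotient.liftₐ I (aeval ![F', H', K']) fun P hP => hI hP,
      aeval_X _ 0, aeval_X _ 1, aeval_X _ 2⟩
  refine ⟨fun h => hrel.coefficients_of_linearIndependent h.1, ?_⟩
  rintro ⟨rfl, rfl, rfl, rfl, rfl⟩
  constructor
  · obtain ⟨F₁, H₁, h₁⟩ := exists_curveRelations_laurentSeries π a b e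
    obtain ⟨g, K₂, h₂⟩ := exists_curveRelations_quadraticAlgebra π a b e
    obtain ⟨f₁, hF₁, hH₁, hK₁⟩ := lift h₁
    obtain ⟨f₂, hF₂, hH₂, -⟩ := lift h₂
    exact linearIndependent_normalMonomial f₁ f₂ hF₁ hH₁ hK₁ hF₂ hH₂
  · rw [eq_top_iff]
    rintro x -
    obtain ⟨P, rfl⟩ := Ideal.Quotient.mk_surjective x
    have haeval : aeval ![mk F, mk H, mk K] = Ideal.Quotient.mkₐ R I := by
      ext j
      fin_cases j <;> simp [mk, F, H, K]
    have hP := hrel.aeval_mem_span P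
    rw [haeval] at hP
    exact hP
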